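/- arXiv:1611.01992 — 3 statements merged into one kernel-verified Lean document; each statement's English description precedes it below -/
import Mathlib

section
/- Simple finite-dimensional Lie double algebras do not exist: if K is a field, V a finite-dimensional K-vector space, and D : V ⊗[K] V → V ⊗[K] V a double bracket satisfying the double Lie identities with D ≠ 0, then there exists an ideal I of the double algebra (V, D) with I ≠ 0 and I ≠ V. -/
open TensorProduct

section DoubleDefs

variable (K : Type*) [Field K] (X : Type*) [AddCommGroup X] [Module K X]

/-- The flip `v ⊗ w ↦ w ⊗ v` on `X ⊗ X`. -/
noncomputable def flipT : X ⊗[K] X →ₗ[K] X ⊗[K] X := (TensorProduct.comm K X X).toLinearMap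

/-- The permutation `τ₁₂ = τ ⊗ id` on `(X ⊗ X) ⊗ X`. -/
noncomputable def t12 : (X ⊗[K] X) ⊗[K] X →ₗ[K] (X ⊗[K] X) ⊗[K] X :=
  TensorProduct.map (flipT K X) LinearMap.id

/-- The permutation `τ₂₃ = id ⊗ τ` on `(X ⊗ X) ⊗ X` (via the canonical associator). -/
noncomputable def t23 : (X ⊗[K] X) ⊗[K] X →ₗ[K] (X ⊗[K] X) ⊗[K] X :=
  (TensorProduct.assoc K X X X).symm.toLinearMap ∘ₗ
    TensorProduct.map LinearMap.id (flipT K X) ∘ₗ (TensorProduct.assoc K X X X).toLinearMap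

variable {K X}

/-- `D ⊗ id` on `(X ⊗ X) ⊗ X`. -/
noncomputable def dL (D : X ⊗[K] X →ₗ[K] X ⊗[K] X) :
    (X ⊗[K] X) ⊗[K] X →ₗ[K] (X ⊗[K] X) ⊗[K] X := TensorProduct.map D LinearMap.id

/-- `id ⊗ D` on `(X ⊗ X) ⊗ X` (via the canonical associator). -/
noncomputable def dR (D : X ⊗[K] X →ₗ[K] X ⊗[K] X) :
    (X ⊗[K] X) ⊗[K] X →ₗ[K] (X ⊗[K] X) ⊗[K] X :=
  (TensorProduct.assoc K X X X).symm.toLinearMap ∘ₗ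
    TensorProduct.map LinearMap.id D ∘ₗ (TensorProduct.assoc K X X X).toLinearMap

/-- `D` satisfies the double Lie identities: anti-symmetry and the double Jacobi identity. -/
def IsDoubleLie (D : X ⊗[K] X →ₗ[K] X ⊗[K] X) : Prop :=
  flipT K X ∘ₗ D ∘ₗ flipT K X = -D ∧
  dL D ∘ₗ dR D - dR D ∘ₗ t12 K X ∘ₗ dR D ∘ₗ t12 K X =
    t23 K X ∘ₗ dL D ∘ₗ t23 K X ∘ₗ dL D

/-- `D` satisfies the double associativity identities. -/
def IsDoubleAssoc (D : X ⊗[K] X →ₗ[K] X ⊗[K] X) : Prop :=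
  dL D ∘ₗ dR D = t23 K X ∘ₗ dL D ∘ₗ t23 K X ∘ₗ dL D ∧
  t12 K X ∘ₗ dR D ∘ₗ t12 K X ∘ₗ dR D = dR D ∘ₗ dL D

/-- The image of `I ⊗ X` in `X ⊗ X`. -/
noncomputable def sideL (I : Submodule K X) : Submodule K (X ⊗[K] X) :=
  LinearMap.range (TensorProduct.map I.subtype (LinearMap.id : X →ₗ[K] X))

/-- The image of `X ⊗ I` in `X ⊗ X`. -/
noncomputable def sideR (I : Submodule K X) : Submodule K (X ⊗[K] X) :=
  LinearMap.range (TensorProduct.map (LinearMap.id : X →ₗ[K] X) I.subtype)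

/-- `I` is an ideal of the double algebra `(X, D)`:
`D` maps `I⊗X + X⊗I` into `I⊗X + X⊗I`. -/
def IsDoubleIdeal (D : X ⊗[K] X →ₗ[K] X ⊗[K] X) (I : Submodule K X) : Prop :=
  Submodule.map D (sideL I ⊔ sideR I) ≤ sideL I ⊔ sideR I

/-- The double algebra `(X, D)` is simple. -/
def IsSimpleDouble (D : X ⊗[K] X →ₗ[K] X ⊗[K] X) : Prop :=
  D ≠ 0 ∧ ∀ I : Submodule K X, IsDoubleIdeal D I → I = ⊥ ∨ I = ⊤

end DoubleDefs

section ContractedOperators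

variable {K V : Type*} [Field K] [AddCommGroup V] [Module K V]

/-- Contraction of the first tensor factor with a functional. -/
noncomputable def contractFst (φ : Module.Dual K V) : V ⊗[K] V →ₗ[K] V :=
  TensorProduct.lift ((LinearMap.lsmul K V).comp φ)

@[simp]
lemma contractFst_tmul (φ : Module.Dual K V) (v w : V) :
    contractFst φ (v ⊗ₜ[K] w) = φ v • w := rfl

/-- Contraction of the first two factors of `(V ⊗ V) ⊗ V` with functionals. -/
noncomputable def contractFstSnd (φ ψ : Module.Dual K V) : (V ⊗[K] V) ⊗[K] V →ₗ[K] V :=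
  TensorProduct.lift ((LinearMap.lsmul K V).comp (ψ.comp (contractFst φ)))

@[simp]
lemma contractFstSnd_tmul (φ ψ : Module.Dual K V) (t : V ⊗[K] V) (w : V) :
    contractFstSnd φ ψ (t ⊗ₜ[K] w) = ψ (contractFst φ t) • w := rfl

/-- The operator `u ↦ (φ ⊗ id) (D (v ⊗ u))`, bilinear in `φ` and `v`. -/
noncomputable def bracketOp (D : V ⊗[K] V →ₗ[K] V ⊗[K] V) :
    Module.Dual K V →ₗ[K] V →ₗ[K] Module.End K V :=
  LinearMap.mk₂ K (fun φ v => contractFst φ ∘ₗ D ∘ₗ TensorProduct.mk K V V v)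
    (fun φ ψ v => by
      ext u
      have h : contractFst (φ + ψ) = contractFst φ + contractFst ψ := by
        ext a b; simp [add_smul]
      simp [h])
    (fun c φ v => by
      ext u
      have h : contractFst (c • φ) = c • contractFst φ := by
        ext a b; simp [mul_smul]
      simp [h])
    (fun φ v w => by ext u; simp)
    (fun c φ v => by ext u; simp)

lemma bracketOp_apply (D : V ⊗[K] V →ₗ[K] V ⊗[K] V) (φ : Module.Dual K V) (v u : V) :
    bracketOp D φ v u = contractFst φ (D (v ⊗ₜ u)) := rfl

lemma IsDoubleLie.apply_tmul {D : V ⊗[K] V →ₗ[K] V ⊗[K] V} (h : IsDoubleLie D) (v w : V) :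
    D (v ⊗ₜ w) = -flipT K V (D (w ⊗ₜ v)) := by
  have := LinearMap.congr_fun h.1 (v ⊗ₜ[K] w)
  simp only [flipT, LinearMap.comp_apply, LinearEquiv.coe_coe, TensorProduct.comm_tmul,
    LinearMap.neg_apply] at this ⊢
  rw [this, neg_neg]

lemma contractFstSnd_dL_assoc_symm (D : V ⊗[K] V →ₗ[K] V ⊗[K] V) (φ ψ : Module.Dual K V)
    (v : V) (t : V ⊗[K] V) :
    contractFstSnd φ ψ (dL D ((TensorProduct.assoc K V V V).symm (v ⊗ₜ t))) =
      contractFst (ψ ∘ₗ bracketOp D φ v) t := by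
  induction t with
  | zero => simp
  | tmul a b => simp [dL, bracketOp_apply]
  | add a b ha hb => simp only [TensorProduct.tmul_add, map_add, ha, hb]

lemma contractFstSnd_assoc_symm (φ ψ : Module.Dual K V) (v : V) (t : V ⊗[K] V) :
    contractFstSnd φ ψ ((TensorProduct.assoc K V V V).symm (v ⊗ₜ t)) =
      φ v • contractFst ψ t := by
  induction t with
  | zero => simp
  | tmul a b => simp [mul_smul]
  | add a b ha hb => simp only [TensorProduct.tmul_add, map_add, ha, hb, smul_add]

lemma contractFstSnd_dR_t12 (D : V ⊗[K] V →ₗ[K] V ⊗[K] V) (φ ψ : Module.Dual K V)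
    (w : V) (t : V ⊗[K] V) :
    contractFstSnd φ ψ (dR D (t12 K V ((TensorProduct.assoc K V V V).symm (w ⊗ₜ t)))) =
      bracketOp D ψ w (contractFst φ t) := by
  induction t with
  | zero => simp
  | tmul a b => simp [dR, t12, flipT, contractFstSnd_assoc_symm, bracketOp_apply]
  | add a b ha hb => simp only [TensorProduct.tmul_add, map_add, ha, hb]

lemma contractFstSnd_t23_tmul (φ ψ : Module.Dual K V) (t : V ⊗[K] V) (w : V) :
    contractFstSnd φ ψ (t23 K V (t ⊗ₜ w)) = ψ w • contractFst φ t := by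
  induction t with
  | zero => simp
  | tmul a b => simp [t23, flipT, smul_smul, mul_comm]
  | add a b ha hb => simp only [TensorProduct.add_tmul, map_add, ha, hb, smul_add]

lemma contractFstSnd_t23_dL_t23 (D : V ⊗[K] V →ₗ[K] V ⊗[K] V) (φ ψ : Module.Dual K V)
    (u : V) (t : V ⊗[K] V) :
    contractFstSnd φ ψ (t23 K V (dL D (t23 K V (t ⊗ₜ u)))) =
      bracketOp D φ (contractFst ψ (flipT K V t)) u := by
  induction t with
  | zero => simp
  | tmul a b =>
    have h : t23 K V ((a ⊗ₜ b) ⊗ₜ u) = (a ⊗ₜ u) ⊗ₜ b := by simp [t23, flipT]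
    simp [h, dL, contractFstSnd_t23_tmul, flipT, bracketOp_apply]
  | add a b ha hb =>
    simp only [TensorProduct.add_tmul, map_add, ha, hb, LinearMap.add_apply]

/-- The double Jacobi identity, contracted with functionals in the first two factors. -/
lemma IsDoubleLie.bracketOp_mul {D : V ⊗[K] V →ₗ[K] V ⊗[K] V} (h : IsDoubleLie D)
    (φ ψ : Module.Dual K V) (v w : V) :
    bracketOp D ψ w * bracketOp D φ v =
      bracketOp D φ (bracketOp D ψ w v) + bracketOp D (ψ ∘ₗ bracketOp D φ v) w := by
  ext u
  have hJ := congrArg (contractFstSnd φ ψ) (LinearMap.congr_fun h.2 ((v ⊗ₜ[K] w) ⊗ₜ[K] u))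
  have h₁ : dR D ((v ⊗ₜ[K] w) ⊗ₜ[K] u) =
      (TensorProduct.assoc K V V V).symm (v ⊗ₜ D (w ⊗ₜ u)) := by simp [dR]
  have h₂ : dR D (t12 K V ((v ⊗ₜ[K] w) ⊗ₜ[K] u)) =
      (TensorProduct.assoc K V V V).symm (w ⊗ₜ D (v ⊗ₜ u)) := by simp [dR, t12, flipT]
  have h₃ : dL D ((v ⊗ₜ[K] w) ⊗ₜ[K] u) = D (v ⊗ₜ w) ⊗ₜ u := by simp [dL]
  have h₄ : contractFst ψ (flipT K V (D (v ⊗ₜ w))) = -bracketOp D ψ w v := by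
    rw [bracketOp_apply, h.apply_tmul w v, map_neg, neg_neg]
  simp only [LinearMap.sub_apply, LinearMap.comp_apply, map_sub, h₁, h₂, h₃,
    contractFstSnd_dL_assoc_symm, contractFstSnd_dR_t12, contractFstSnd_t23_dL_t23, h₄,
    map_neg, LinearMap.neg_apply] at hJ
  simp only [← bracketOp_apply] at hJ
  simp only [Module.End.mul_apply, LinearMap.add_apply]
  rw [sub_eq_iff_eq_add] at hJ
  rw [hJ]
  abel

end ContractedOperators

section RotaBaxter

variable {K V ι : Type*} [Field K] [AddCommGroup V] [Module K V] [Fintype ι]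

/-- The operator `R` on `End V` determined by the double bracket: if `D = ∑ aᵢ ⊗ bᵢ` in
`End V ⊗ End V`, then `R x = ∑ tr (aᵢ x) bᵢ`. -/
noncomputable def rotaBaxterOp (e : Module.Basis ι K V) (D : V ⊗[K] V →ₗ[K] V ⊗[K] V) :
    Module.End K V →ₗ[K] Module.End K V :=
  ∑ i, bracketOp D (e.coord i) ∘ₗ LinearMap.applyₗ (e i)

lemma rotaBaxterOp_apply (e : Module.Basis ι K V) (D : V ⊗[K] V →ₗ[K] V ⊗[K] V)
    (x : Module.End K V) :
    rotaBaxterOp e D x = ∑ i, bracketOp D (e.coord i) (x (e i)) := by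
  simp [rotaBaxterOp]

lemma comp_eq_sum_coord (e : Module.Basis ι K V) (φ : Module.Dual K V)
    (f : Module.End K V) : φ ∘ₗ f = ∑ j, φ (f (e j)) • e.coord j := by
  classical
  refine e.ext fun j => ?_
  simp [Finsupp.single_apply]

lemma bracketOp_mem_range_rotaBaxterOp (e : Module.Basis ι K V)
    (D : V ⊗[K] V →ₗ[K] V ⊗[K] V) (φ : Module.Dual K V) (v : V) :
    bracketOp D φ v ∈ LinearMap.range (rotaBaxterOp e D) := by
  refine ⟨φ.smulRight v, ?_⟩
  have h := comp_eq_sum_coord e φ LinearMap.id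
  rw [LinearMap.comp_id] at h
  rw [rotaBaxterOp_apply]
  conv_rhs => rw [h, map_sum, LinearMap.sum_apply]
  simp

lemma sum_bracketOp_coord_comp (e : Module.Basis ι K V) (D : V ⊗[K] V →ₗ[K] V ⊗[K] V)
    (x f : Module.End K V) :
    ∑ i, bracketOp D (e.coord i ∘ₗ f) (x (e i)) = rotaBaxterOp e D (x * f) := by
  have h (j : ι) : x (f (e j)) = ∑ i, e.coord i (f (e j)) • x (e i) := by
    conv_lhs => rw [← e.sum_repr (f (e j)), map_sum]
    simp only [map_smul, e.coord_apply]
  simp only [rotaBaxterOp_apply, comp_eq_sum_coord e _ f, Module.End.mul_apply, h, map_sum,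
    map_smul, LinearMap.sum_apply, LinearMap.smul_apply]
  exact Finset.sum_comm

/-- The operator of a double Lie algebra satisfies the Rota–Baxter identity of weight zero. -/
lemma IsDoubleLie.rotaBaxterOp_mul {D : V ⊗[K] V →ₗ[K] V ⊗[K] V} (h : IsDoubleLie D)
    (e : Module.Basis ι K V) (x y : Module.End K V) :
    rotaBaxterOp e D y * rotaBaxterOp e D x =
      rotaBaxterOp e D (rotaBaxterOp e D y * x) + rotaBaxterOp e D (y * rotaBaxterOp e D x) := by
  rw [← sum_bracketOp_coord_comp e D y, rotaBaxterOp_apply e D (_ * x)]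
  simp only [Module.End.mul_apply]
  conv_lhs => rw [rotaBaxterOp_apply e D x, rotaBaxterOp_apply e D y]
  simp only [Finset.sum_mul_sum, h.bracketOp_mul, Finset.sum_add_distrib]
  congr 1
  · rw [Finset.sum_comm]
    simp [rotaBaxterOp_apply e D y, LinearMap.sum_apply]
  · have hcomp (φ : Module.Dual K V) : φ ∘ₗ rotaBaxterOp e D x =
        ∑ j, φ ∘ₗ bracketOp D (e.coord j) (x (e j)) := by
      ext u
      simp only [rotaBaxterOp_apply, LinearMap.comp_apply, LinearMap.sum_apply, map_sum]
    simp only [hcomp, map_sum, LinearMap.sum_apply]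

lemma IsDoubleLie.one_notMem_range_rotaBaxterOp [Nontrivial V]
    {D : V ⊗[K] V →ₗ[K] V ⊗[K] V} (h : IsDoubleLie D) (e : Module.Basis ι K V) :
    (1 : Module.End K V) ∉ LinearMap.range (rotaBaxterOp e D) := by
  rintro ⟨x, hx⟩
  have := h.rotaBaxterOp_mul e x x
  rw [hx, one_mul, one_mul, mul_one, hx] at this
  exact one_ne_zero (left_eq_add.mp this)

lemma eq_sum_tmul_contractFst (e : Module.Basis ι K V) (t : V ⊗[K] V) :
    t = ∑ i, e i ⊗ₜ contractFst (e.coord i) t := by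
  induction t with
  | zero => simp
  | tmul a b =>
    conv_lhs => rw [← e.sum_repr a]
    simp only [TensorProduct.sum_tmul, contractFst_tmul, e.coord_apply, TensorProduct.smul_tmul]
  | add a b ha hb =>
    conv_lhs => rw [ha, hb]
    simp [TensorProduct.tmul_add, Finset.sum_add_distrib]

lemma isDoubleIdeal_of_invariant {D : V ⊗[K] V →ₗ[K] V ⊗[K] V} (h : IsDoubleLie D)
    (e : Module.Basis ι K V) (I : Submodule K V)
    (hI : ∀ φ v, ∀ u ∈ I, bracketOp D φ v u ∈ I) : IsDoubleIdeal D I := by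
  have hR (v u : V) (hu : u ∈ I) : v ⊗ₜ u ∈ sideR (K := K) I := ⟨v ⊗ₜ ⟨u, hu⟩, by simp⟩
  have hL (t : V ⊗[K] V) (ht : t ∈ sideR I) : flipT K V t ∈ sideL I := by
    obtain ⟨s, rfl⟩ := ht
    refine ⟨TensorProduct.comm K V I s, ?_⟩
    simp [flipT, TensorProduct.map_comm]
  have hD (v u : V) (hu : u ∈ I) : D (v ⊗ₜ u) ∈ sideR I := by
    rw [eq_sum_tmul_contractFst e (D (v ⊗ₜ u))]
    exact Submodule.sum_mem _ fun i _ => hR _ _ (hI _ _ _ hu)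
  unfold IsDoubleIdeal
  rw [Submodule.map_sup]
  refine sup_le ?_ ?_
  · refine le_trans ?_ le_sup_left
    rintro _ ⟨_, ⟨s, rfl⟩, rfl⟩
    induction s with
    | zero => simp
    | tmul a b =>
      rw [TensorProduct.map_tmul, h.apply_tmul]
      exact neg_mem (hL _ (hD _ _ a.2))
    | add a b ha hb => rw [map_add, map_add]; exact add_mem ha hb
  · refine le_trans ?_ le_sup_right
    rintro _ ⟨_, ⟨s, rfl⟩, rfl⟩
    induction s with
    | zero => simp
    | tmul a b => exact hD _ _ b.2
    | add a b ha hb => rw [map_add, map_add]; exact add_mem ha hb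

end RotaBaxter

section Irreducible

variable {K V : Type*} [Field K] [AddCommGroup V] [Module K V] [FiniteDimensional K V]

/-- A nonzero subspace of `End V` closed under multiplication and acting irreducibly on a
finite-dimensional `V` contains the identity. -/
lemma one_mem_of_irreducible (S : Submodule K (Module.End K V)) (hS : S ≠ ⊥)
    (hmul : ∀ s ∈ S, ∀ t ∈ S, s * t ∈ S)
    (hirr : ∀ W : Submodule K V, (∀ s ∈ S, ∀ w ∈ W, s w ∈ W) → W = ⊥ ∨ W = ⊤) :
    (1 : Module.End K V) ∈ S := by
  let A : Subalgebra K (Module.End K V) :=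
    { carrier := {a | ∀ s ∈ S, a * s ∈ S}
      mul_mem' := fun ha hb s hs => by rw [mul_assoc]; exact ha _ (hb _ hs)
      add_mem' := fun ha hb s hs => by rw [add_mul]; exact S.add_mem (ha _ hs) (hb _ hs)
      algebraMap_mem' := fun c s hs => by
        rw [Algebra.algebraMap_eq_smul_one, smul_mul_assoc, one_mul]; exact S.smul_mem c hs }
  have hSA (s) (hs : s ∈ S) : s ∈ A := hmul s hs
  have hnt : Nontrivial V := by
    by_contra hV
    rw [not_nontrivial_iff_subsingleton] at hV
    exact hS (Subsingleton.elim _ _)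
  have hsimple : IsSimpleModule A V := by
    rw [isSimpleModule_iff]
    exact
      { eq_bot_or_eq_top := fun W => by
          have := hirr (W.restrictScalars K) fun s hs w hw => W.smul_mem ⟨s, hSA s hs⟩ hw
          simpa using this }
  have hann (c : V) (hc : ∀ s ∈ S, s c = 0) : c = 0 := by
    let N : Submodule K V := ⨅ s : S, LinearMap.ker (s : Module.End K V)
    have hN (x : V) : x ∈ N ↔ ∀ s ∈ S, s x = 0 := by simp [N]
    rcases hirr N fun s hs w hw => by rw [(hN w).1 hw s hs]; exact N.zero_mem with h | h
    · exact (Submodule.mem_bot K).1 (h ▸ (hN c).2 hc)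
    · refine absurd ((Submodule.eq_bot_iff S).2 fun s hs => ?_) hS
      ext x
      exact (hN x).1 (h ▸ Submodule.mem_top) s hs
  let e := Module.finBasis K V
  let P : Submodule A (Fin (Module.finrank K V) → V) :=
    { carrier := {f | ∃ s ∈ S, ∀ i, f i = s (e i)}
      zero_mem' := ⟨0, S.zero_mem, by simp⟩
      add_mem' := by
        rintro f g ⟨s, hs, hf⟩ ⟨t, ht, hg⟩
        exact ⟨s + t, S.add_mem hs ht, fun i => by simp [hf, hg]⟩
      smul_mem' := by
        rintro a f ⟨s, hs, hf⟩
        exact ⟨a * s, a.2 s hs, fun i => by rw [Pi.smul_apply, hf]; rfl⟩ }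
  obtain ⟨C, hC⟩ := exists_isCompl P
  obtain ⟨p, ⟨s, hs, hp⟩, c, hc, hpc⟩ :=
    Submodule.mem_sup.1 (hC.sup_eq_top ▸ Submodule.mem_top : (e : _ → V) ∈ P ⊔ C)
  have hc0 (t) (ht : t ∈ S) (i) : t (c i) = 0 := by
    have h₁ : (⟨t, hSA t ht⟩ : A) • c ∈ C := C.smul_mem _ hc
    have h₂ : (⟨t, hSA t ht⟩ : A) • c ∈ P := by
      refine ⟨t - t * s, S.sub_mem ht (hmul _ ht _ hs), fun j => ?_⟩
      have : c j = e j - s (e j) := by rw [← hp, ← hpc]; simp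
      rw [Pi.smul_apply, this]
      exact map_sub t _ _
    exact congrFun (Submodule.disjoint_def.1 hC.disjoint _ h₂ h₁) i
  have : s = 1 := e.ext fun i => by
    have h := congrFun hpc i
    rw [Pi.add_apply, hann _ fun t ht => hc0 t ht i, add_zero, hp] at h
    exact h
  exact this ▸ hs

end Irreducible

/-- Simple finite-dimensional Lie double algebras do not exist: every finite-dimensional
Lie double algebra with nonzero double bracket has a nonzero proper ideal. -/
theorem stmt8 {K V : Type*} [Field K] [AddCommGroup V] [Module K V]
    [FiniteDimensional K V]
    (D : V ⊗[K] V →ₗ[K] V ⊗[K] V) (hLie : IsDoubleLie D) (hne : D ≠ 0) :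
    ∃ I : Submodule K V, IsDoubleIdeal D I ∧ I ≠ ⊥ ∧ I ≠ ⊤ := by
  let e := Module.finBasis K V
  let S := LinearMap.range (rotaBaxterOp e D)
  by_contra! hno
  have hnt : Nontrivial V := by
    by_contra hV
    rw [not_nontrivial_iff_subsingleton] at hV
    exact hne (LinearMap.ext fun t => Subsingleton.elim _ _)
  refine hLie.one_notMem_range_rotaBaxterOp e (one_mem_of_irreducible S ?_ ?_ ?_)
  · intro hS
    have hzero (φ : Module.Dual K V) (v : V) : bracketOp D φ v = 0 :=
      (Submodule.mem_bot K).1 (hS ▸ bracketOp_mem_range_rotaBaxterOp e D φ v)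
    refine hne (TensorProduct.ext' fun v u => ?_)
    rw [eq_sum_tmul_contractFst e (D (v ⊗ₜ u))]
    simp [← bracketOp_apply, hzero]
  · rintro _ ⟨y, rfl⟩ _ ⟨x, rfl⟩
    rw [hLie.rotaBaxterOp_mul, ← map_add]
    exact LinearMap.mem_range_self _ _
  · intro W hW
    have hideal := isDoubleIdeal_of_invariant hLie e W fun φ v u hu =>
      hW _ (bracketOp_mem_range_rotaBaxterOp e D φ v) u hu
    by_cases h : W = ⊥
    · exact Or.inl h
    · exact Or.inr (hno W hideal h)
end

section
/- Let K be a field, V a finite-dimensional K-vector space, and D : V ⊗[K] V → V ⊗[K] V a double bracket satisfying the double associativity identities such that the double algebra (V, D) is simple. Then D is commutative: τ∘D∘τ = D, where τ : V⊗V → V⊗V is the flip. -/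
open TensorProduct

section TensorContraction

variable {K P Q : Type*} [Field K] [AddCommGroup P] [Module K P] [AddCommGroup Q] [Module K Q]

/-- Contraction of the right factor of `P ⊗ Q` with a linear form on `Q`. -/
noncomputable def contractTensorRight (φ : Q →ₗ[K] K) : P ⊗[K] Q →ₗ[K] P :=
  (TensorProduct.rid K P).toLinearMap ∘ₗ φ.lTensor P

/-- Contraction of the left factor of `P ⊗ Q` with a linear form on `P`. -/
noncomputable def contractTensorLeft (φ : P →ₗ[K] K) : P ⊗[K] Q →ₗ[K] Q :=
  (TensorProduct.lid K Q).toLinearMap ∘ₗ φ.rTensor Q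

@[simp] lemma contractTensorRight_tmul (φ : Q →ₗ[K] K) (p : P) (q : Q) :
    contractTensorRight φ (p ⊗ₜ[K] q) = φ q • p := by
  simp [contractTensorRight]

@[simp] lemma contractTensorLeft_tmul (φ : P →ₗ[K] K) (p : P) (q : Q) :
    contractTensorLeft φ (p ⊗ₜ[K] q) = φ p • q := by
  simp [contractTensorLeft]

lemma LinearIndependent.exists_linearForm {ι : Type*} {b : ι → Q} (hb : LinearIndependent K b)
    (c : ι → K) : ∃ φ : Q →ₗ[K] K, ∀ i, φ (b i) = c i := by
  obtain ⟨φ, hφ⟩ := LinearMap.exists_extend (Finsupp.linearCombination K c ∘ₗ hb.repr)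
  refine ⟨φ, fun i ↦ ?_⟩
  have h := LinearMap.congr_fun hφ ⟨b i, Submodule.subset_span ⟨i, rfl⟩⟩
  have h' : hb.repr ⟨b i, Submodule.subset_span ⟨i, rfl⟩⟩ = Finsupp.single i 1 :=
    hb.repr_eq_single i _ rfl
  simpa [h'] using h

lemma sum_tmul_right_injective {ι : Type*} [Fintype ι] {b : ι → Q} (hb : LinearIndependent K b)
    {x y : ι → P} (h : ∑ i, x i ⊗ₜ[K] b i = ∑ i, y i ⊗ₜ[K] b i) (i : ι) : x i = y i := by
  classical
  obtain ⟨φ, hφ⟩ := hb.exists_linearForm (Pi.single i 1)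
  simpa [hφ, Pi.single_apply] using congrArg (contractTensorRight φ) h

lemma sum_tmul_left_injective {ι : Type*} [Fintype ι] {a : ι → P} (ha : LinearIndependent K a)
    {x y : ι → Q} (h : ∑ i, a i ⊗ₜ[K] x i = ∑ i, a i ⊗ₜ[K] y i) (i : ι) : x i = y i := by
  classical
  obtain ⟨φ, hφ⟩ := ha.exists_linearForm (Pi.single i 1)
  simpa [hφ, Pi.single_apply] using congrArg (contractTensorLeft φ) h

/-- The left coefficients of a tensor along independent right factors lie in the span of the left
factors of any other expression of this tensor. -/
lemma mem_span_of_sum_tmul_eq {ι κ : Type*} [Fintype ι] [Fintype κ] {b : ι → Q}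
    (hb : LinearIndependent K b) {x : ι → P} {a : κ → P} {y : κ → Q}
    (h : ∑ i, x i ⊗ₜ[K] b i = ∑ k, a k ⊗ₜ[K] y k) (i : ι) :
    x i ∈ Submodule.span K (Set.range a) := by
  classical
  obtain ⟨φ, hφ⟩ := hb.exists_linearForm (Pi.single i 1)
  have h' : x i = ∑ k, φ (y k) • a k := by
    simpa [hφ, Pi.single_apply] using congrArg (contractTensorRight φ) h
  rw [h']
  exact Submodule.sum_mem _ fun k _ ↦
    Submodule.smul_mem _ _ (Submodule.subset_span ⟨k, rfl⟩)

lemma mem_span_of_sum_tmul_eq' {ι κ : Type*} [Fintype ι] [Fintype κ] {a : ι → P}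
    (ha : LinearIndependent K a) {y : ι → Q} {x : κ → P} {b : κ → Q}
    (h : ∑ i, a i ⊗ₜ[K] y i = ∑ k, x k ⊗ₜ[K] b k) (i : ι) :
    y i ∈ Submodule.span K (Set.range b) := by
  refine mem_span_of_sum_tmul_eq ha (x := y) (a := b) (y := x) ?_ i
  simpa using congrArg (TensorProduct.comm K P Q) h

lemma exists_sum_tmul_basis_span {k : ℕ} (m : Fin k → P) (n : Fin k → Q) :
    ∃ (m' : Fin (Module.finrank K (Submodule.span K (Set.range n))) → P)
      (n' : Fin (Module.finrank K (Submodule.span K (Set.range n))) → Q),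
      ∑ j, m j ⊗ₜ[K] n j = ∑ j, m' j ⊗ₜ[K] n' j := by
  have : FiniteDimensional K (Submodule.span K (Set.range n)) :=
    FiniteDimensional.span_of_finite K (Set.finite_range n)
  let B := Module.finBasis K (Submodule.span K (Set.range n))
  let N : Fin k → Submodule.span K (Set.range n) :=
    fun j ↦ ⟨n j, Submodule.subset_span ⟨j, rfl⟩⟩
  refine ⟨fun i ↦ ∑ j, B.repr (N j) i • m j, fun i ↦ (B i : Q), ?_⟩
  have hN (j) : n j = ∑ i, B.repr (N j) i • (B i : Q) := by
    have := congrArg (Submodule.span K (Set.range n)).subtype (B.sum_repr (N j))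
    simp only [map_sum, map_smul, Submodule.subtype_apply] at this
    exact this.symm
  conv_lhs => enter [2, j]; rw [hN j]
  simp only [TensorProduct.tmul_sum, TensorProduct.sum_tmul, TensorProduct.tmul_smul,
    TensorProduct.smul_tmul']
  exact Finset.sum_comm

/-- Every tensor is a sum of pure tensors with independent left and independent right factors. -/
lemma exists_sum_tmul_linearIndependent (x : P ⊗[K] Q) :
    ∃ (k : ℕ) (a : Fin k → P) (b : Fin k → Q), LinearIndependent K a ∧ LinearIndependent K b ∧
      x = ∑ i, a i ⊗ₜ[K] b i := by
  classical
  have hex : ∃ k : ℕ, ∃ (a : Fin k → P) (b : Fin k → Q), x = ∑ i, a i ⊗ₜ[K] b i :=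
    TensorProduct.exists_sum_tmul_eq x
  obtain ⟨a, b, hx⟩ := Nat.find_spec hex
  refine ⟨_, a, b, ?_, ?_, hx⟩
  · rw [linearIndependent_iff_card_le_finrank_span, Fintype.card_fin]
    obtain ⟨b', a', h⟩ := exists_sum_tmul_basis_span (K := K) b a
    have h' : ∑ j, a j ⊗ₜ[K] b j = ∑ j, a' j ⊗ₜ[K] b' j := by
      simpa using congrArg (TensorProduct.comm K Q P).toLinearMap h
    exact Nat.find_min' hex ⟨a', b', hx.trans h'⟩
  · rw [linearIndependent_iff_card_le_finrank_span, Fintype.card_fin]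
    obtain ⟨a', b', h⟩ := exists_sum_tmul_basis_span (K := K) a b
    exact Nat.find_min' hex ⟨a', b', hx.trans h⟩

end TensorContraction

section OperatorAlgebras

variable {K V : Type*} [Field K] [AddCommGroup V] [Module K V] [FiniteDimensional K V]

/-- A subspace of operators closed under `l, m ↦ l + m - m * l` and fixing each vector by some
element contains the identity. -/
lemma one_mem_of_forall_exists_apply_eq (L : Submodule K (Module.End K V)) (hLL : L * L ≤ L)
    (hfix : ∀ w, ∃ m ∈ L, m w = w) : 1 ∈ L := by
  obtain ⟨W, ⟨l, hl, rfl⟩, hmax⟩ := (wellFounded_gt (α := Submodule K V)).has_min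
    {W : Submodule K V | ∃ l ∈ L, LinearMap.ker (1 - l) = W} ⟨_, 0, L.zero_mem, rfl⟩
  suffices h : (1 : Module.End K V) - l = 0 by rwa [sub_eq_zero.mp h]
  ext v
  obtain ⟨m, hm, hmv⟩ := hfix ((1 - l) v)
  have hmem : l + m - m * l ∈ L := L.sub_mem (L.add_mem hl hm) (hLL (Submodule.mul_mem_mul hm hl))
  have heq : (1 : Module.End K V) - (l + m - m * l) = (1 - m) * (1 - l) := by noncomm_ring
  have hle : LinearMap.ker (1 - l) ≤ LinearMap.ker (1 - (l + m - m * l)) := by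
    intro u hu
    rw [heq, LinearMap.mem_ker, Module.End.mul_apply, LinearMap.mem_ker.mp hu, map_zero]
  have hle' := not_lt_iff_le_imp_ge.mp (hmax _ ⟨_, hmem, rfl⟩) hle
  refine hle' ?_
  rw [heq, LinearMap.mem_ker, Module.End.mul_apply, LinearMap.sub_apply, hmv]
  simp

lemma one_mem_of_irreducible_s16 (L M : Submodule K (Module.End K V))
    (hLL : L * L ≤ L) (hML : M * L ≤ M) (hMM : M * M ≤ M) (hLM : L * M ≤ L)
    (hann : ∀ v, (∀ x ∈ L, x v = 0) → v = 0)
    (himg : ∀ I : Submodule K V, (∀ x ∈ L, ∀ v, x v ∈ I) → I = ⊤)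
    (hirr : ∀ I : Submodule K V, (∀ x ∈ L ⊔ M, ∀ v ∈ I, x v ∈ I) → I = ⊥ ∨ I = ⊤) :
    1 ∈ L := by
  refine one_mem_of_forall_exists_apply_eq L hLL fun w ↦ ?_
  by_cases hw : w = 0
  · exact ⟨0, L.zero_mem, by simp [hw]⟩
  have hBB : (L ⊔ M) * (L ⊔ M) ≤ L ⊔ M := by
    rw [Submodule.sup_mul, Submodule.mul_sup, Submodule.mul_sup]
    exact sup_le (sup_le (hLL.trans le_sup_left) (hLM.trans le_sup_left))
      (sup_le (hML.trans le_sup_right) (hMM.trans le_sup_right))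
  have hLB : L * (L ⊔ M) ≤ L := by
    rw [Submodule.mul_sup]
    exact sup_le hLL hLM
  obtain ⟨a, ha, haw⟩ : ∃ a ∈ L, a w ≠ 0 := by
    by_contra! h
    exact hw (hann w h)
  obtain ⟨c, hc, hcw⟩ : ∃ c ∈ L, c (a w) ≠ 0 := by
    by_contra! h
    exact haw (hann _ h)
  have htop : (L ⊔ M).map (LinearMap.applyₗ (a w)) = ⊤ := by
    refine (hirr _ ?_).resolve_left fun h ↦ hcw ?_
    · rintro x hx _ ⟨y, hy, rfl⟩
      exact ⟨x * y, hBB (Submodule.mul_mem_mul hx hy), rfl⟩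
    · rw [← Submodule.mem_bot K, ← h]
      exact ⟨c, Submodule.mem_sup_left hc, rfl⟩
  have hLw : L.map (LinearMap.applyₗ w) = ⊤ := by
    refine himg _ fun x hx v ↦ ?_
    obtain ⟨y, hy, rfl⟩ : v ∈ (L ⊔ M).map (LinearMap.applyₗ (a w)) := htop ▸ Submodule.mem_top
    exact ⟨x * y * a, hLL (Submodule.mul_mem_mul (hLB (Submodule.mul_mem_mul hx hy)) ha), rfl⟩
  exact (hLw ▸ Submodule.mem_top : w ∈ L.map (LinearMap.applyₗ w))

end OperatorAlgebras

section DoubleBracket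

variable {K V : Type*} [Field K] [AddCommGroup V] [Module K V]

@[simp] lemma flipT_tmul (x y : V) : flipT K V (x ⊗ₜ[K] y) = y ⊗ₜ[K] x := rfl

@[simp] lemma t12_tmul (x y z : V) :
    t12 K V ((x ⊗ₜ[K] y) ⊗ₜ[K] z) = (y ⊗ₜ[K] x) ⊗ₜ[K] z := rfl

@[simp] lemma t23_tmul (x y z : V) :
    t23 K V ((x ⊗ₜ[K] y) ⊗ₜ[K] z) = (x ⊗ₜ[K] z) ⊗ₜ[K] y := rfl

lemma dL_tmul (D : V ⊗[K] V →ₗ[K] V ⊗[K] V) (x y z : V) :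
    dL D ((x ⊗ₜ[K] y) ⊗ₜ[K] z) = D (x ⊗ₜ[K] y) ⊗ₜ[K] z := rfl

lemma dR_tmul (D : V ⊗[K] V →ₗ[K] V ⊗[K] V) (x y z : V) :
    dR D ((x ⊗ₜ[K] y) ⊗ₜ[K] z) =
      (TensorProduct.assoc K V V V).symm (x ⊗ₜ[K] D (y ⊗ₜ[K] z)) := rfl

lemma tmul_mem_sideL {I : Submodule K V} {x : V} (hx : x ∈ I) (y : V) :
    x ⊗ₜ[K] y ∈ sideL I := ⟨(⟨x, hx⟩ : I) ⊗ₜ[K] y, rfl⟩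

lemma tmul_mem_sideR {I : Submodule K V} (x : V) {y : V} (hy : y ∈ I) :
    x ⊗ₜ[K] y ∈ sideR I := ⟨x ⊗ₜ[K] (⟨y, hy⟩ : I), rfl⟩

lemma isDoubleIdeal_of_forall (D : V ⊗[K] V →ₗ[K] V ⊗[K] V) (I : Submodule K V)
    (hl : ∀ x ∈ I, ∀ y, D (x ⊗ₜ[K] y) ∈ sideL I ⊔ sideR I)
    (hr : ∀ x, ∀ y ∈ I, D (x ⊗ₜ[K] y) ∈ sideL I ⊔ sideR I) : IsDoubleIdeal D I := by
  rw [IsDoubleIdeal, Submodule.map_le_iff_le_comap]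
  refine sup_le ?_ ?_
  · rintro _ ⟨t, rfl⟩
    induction t with
    | zero => simp
    | tmul x y => exact hl x x.2 y
    | add s t hs ht => rw [map_add]; exact Submodule.add_mem _ hs ht
  · rintro _ ⟨t, rfl⟩
    induction t with
    | zero => simp
    | tmul x y => exact hr x y y.2
    | add s t hs ht => rw [map_add]; exact Submodule.add_mem _ hs ht

variable {ι : Type*} [Fintype ι] {a b : ι → Module.End K V} {D : V ⊗[K] V →ₗ[K] V ⊗[K] V}

lemma isDoubleIdeal_of_left_mem (hD : ∀ x y, D (x ⊗ₜ[K] y) = ∑ i, a i x ⊗ₜ[K] b i y)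
    {I : Submodule K V} (hI : ∀ i v, a i v ∈ I) : IsDoubleIdeal D I := by
  have h (x y) : D (x ⊗ₜ[K] y) ∈ sideL I ⊔ sideR I := by
    rw [hD]
    exact Submodule.sum_mem _ fun i _ ↦ Submodule.mem_sup_left (tmul_mem_sideL (hI i x) _)
  exact isDoubleIdeal_of_forall D I (fun x _ y ↦ h x y) (fun x y _ ↦ h x y)

lemma isDoubleIdeal_of_right_mem (hD : ∀ x y, D (x ⊗ₜ[K] y) = ∑ i, a i x ⊗ₜ[K] b i y)
    {I : Submodule K V} (hI : ∀ i v, b i v ∈ I) : IsDoubleIdeal D I := by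
  have h (x y) : D (x ⊗ₜ[K] y) ∈ sideL I ⊔ sideR I := by
    rw [hD]
    exact Submodule.sum_mem _ fun i _ ↦ Submodule.mem_sup_right (tmul_mem_sideR _ (hI i y))
  exact isDoubleIdeal_of_forall D I (fun x _ y ↦ h x y) (fun x y _ ↦ h x y)

lemma isDoubleIdeal_of_invariant_s16 (hD : ∀ x y, D (x ⊗ₜ[K] y) = ∑ i, a i x ⊗ₜ[K] b i y)
    {I : Submodule K V} (ha : ∀ i, ∀ v ∈ I, a i v ∈ I) (hb : ∀ i, ∀ v ∈ I, b i v ∈ I) :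
    IsDoubleIdeal D I := by
  refine isDoubleIdeal_of_forall D I (fun x hx y ↦ ?_) (fun x y hy ↦ ?_)
  · rw [hD]
    exact Submodule.sum_mem _ fun i _ ↦ Submodule.mem_sup_left (tmul_mem_sideL (ha i x hx) _)
  · rw [hD]
    exact Submodule.sum_mem _ fun i _ ↦ Submodule.mem_sup_right (tmul_mem_sideR _ (hb i y hy))

lemma eq_zero_of_forall_tmul (h : ∀ x y, D (x ⊗ₜ[K] y) = 0) : D = 0 := by
  ext x y
  simpa using h x y

section Simple

variable {L M : Submodule K (Module.End K V)}

lemma IsSimpleDouble.eq_zero_of_left (hs : IsSimpleDouble D)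
    (hD : ∀ x y, D (x ⊗ₜ[K] y) = ∑ i, a i x ⊗ₜ[K] b i y)
    (hL : L = Submodule.span K (Set.range a)) (hM : M = Submodule.span K (Set.range b))
    (hLM : L * M ≤ L) (hLL : L * L ≤ L) (v : V) (hv : ∀ x ∈ L, x v = 0) : v = 0 := by
  have haL (i) : a i ∈ L := hL ▸ Submodule.subset_span ⟨i, rfl⟩
  have hbM (i) : b i ∈ M := hM ▸ Submodule.subset_span ⟨i, rfl⟩
  let I : Submodule K V :=
    { carrier := {v | ∀ x ∈ L, x v = 0}
      add_mem' := fun hu hw x hx ↦ by rw [map_add, hu x hx, hw x hx, add_zero]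
      zero_mem' := fun x _ ↦ map_zero x
      smul_mem' := fun c w hw x hx ↦ by rw [map_smul, hw x hx, smul_zero] }
  have hI : IsDoubleIdeal D I := isDoubleIdeal_of_invariant_s16 hD
    (fun i w hw x hx ↦ hw (x * a i) (hLL (Submodule.mul_mem_mul hx (haL i))))
    (fun i w hw x hx ↦ hw (x * b i) (hLM (Submodule.mul_mem_mul hx (hbM i))))
  rcases hs.2 I hI with h | h
  · exact (Submodule.mem_bot K).mp (h ▸ hv : v ∈ (⊥ : Submodule K V))
  · refine absurd (eq_zero_of_forall_tmul fun x y ↦ ?_) hs.1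
    have hx : x ∈ I := h ▸ Submodule.mem_top
    rw [hD]
    exact Finset.sum_eq_zero fun i _ ↦ by rw [hx _ (haL i), TensorProduct.zero_tmul]

lemma IsSimpleDouble.eq_zero_of_right (hs : IsSimpleDouble D)
    (hD : ∀ x y, D (x ⊗ₜ[K] y) = ∑ i, a i x ⊗ₜ[K] b i y)
    (hL : L = Submodule.span K (Set.range a)) (hM : M = Submodule.span K (Set.range b))
    (hML : M * L ≤ M) (hMM : M * M ≤ M) (v : V) (hv : ∀ x ∈ M, x v = 0) : v = 0 := by
  have haL (i) : a i ∈ L := hL ▸ Submodule.subset_span ⟨i, rfl⟩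
  have hbM (i) : b i ∈ M := hM ▸ Submodule.subset_span ⟨i, rfl⟩
  let I : Submodule K V :=
    { carrier := {v | ∀ x ∈ M, x v = 0}
      add_mem' := fun hu hw x hx ↦ by rw [map_add, hu x hx, hw x hx, add_zero]
      zero_mem' := fun x _ ↦ map_zero x
      smul_mem' := fun c w hw x hx ↦ by rw [map_smul, hw x hx, smul_zero] }
  have hI : IsDoubleIdeal D I := isDoubleIdeal_of_invariant_s16 hD
    (fun i w hw x hx ↦ hw (x * a i) (hML (Submodule.mul_mem_mul hx (haL i))))
    (fun i w hw x hx ↦ hw (x * b i) (hMM (Submodule.mul_mem_mul hx (hbM i))))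
  rcases hs.2 I hI with h | h
  · exact (Submodule.mem_bot K).mp (h ▸ hv : v ∈ (⊥ : Submodule K V))
  · refine absurd (eq_zero_of_forall_tmul fun x y ↦ ?_) hs.1
    have hy : y ∈ I := h ▸ Submodule.mem_top
    rw [hD]
    exact Finset.sum_eq_zero fun i _ ↦ by rw [hy _ (hbM i), TensorProduct.tmul_zero]

lemma IsSimpleDouble.eq_top_of_left (hs : IsSimpleDouble D)
    (hD : ∀ x y, D (x ⊗ₜ[K] y) = ∑ i, a i x ⊗ₜ[K] b i y)
    {I : Submodule K V} (hI : ∀ i v, a i v ∈ I) : I = ⊤ := by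
  refine (hs.2 I (isDoubleIdeal_of_left_mem hD hI)).resolve_left ?_
  rintro rfl
  refine hs.1 (eq_zero_of_forall_tmul fun x y ↦ ?_)
  rw [hD]
  exact Finset.sum_eq_zero fun i _ ↦ by
    rw [(Submodule.mem_bot K).mp (hI i x), TensorProduct.zero_tmul]

lemma IsSimpleDouble.eq_top_of_right (hs : IsSimpleDouble D)
    (hD : ∀ x y, D (x ⊗ₜ[K] y) = ∑ i, a i x ⊗ₜ[K] b i y)
    {I : Submodule K V} (hI : ∀ i v, b i v ∈ I) : I = ⊤ := by
  refine (hs.2 I (isDoubleIdeal_of_right_mem hD hI)).resolve_left ?_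
  rintro rfl
  refine hs.1 (eq_zero_of_forall_tmul fun x y ↦ ?_)
  rw [hD]
  exact Finset.sum_eq_zero fun i _ ↦ by
    rw [(Submodule.mem_bot K).mp (hI i y), TensorProduct.tmul_zero]

end Simple

variable [FiniteDimensional K V]

/-- The coefficients of the first double associativity identity. -/
lemma IsDoubleAssoc.sum_tmul_mul (hassoc : IsDoubleAssoc D) (hb : LinearIndependent K b)
    (hD : ∀ x y, D (x ⊗ₜ[K] y) = ∑ i, a i x ⊗ₜ[K] b i y) (j : ι) :
    ∑ i, a i ⊗ₜ[K] (b i * a j) = ∑ i, (a j * a i) ⊗ₜ[K] b i := by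
  apply (homTensorHomEquiv K V V V V).injective
  refine sum_tmul_right_injective hb
    (x := fun j ↦ homTensorHomEquiv K V V V V (∑ i, a i ⊗ₜ[K] (b i * a j)))
    (y := fun j ↦ homTensorHomEquiv K V V V V (∑ i, (a j * a i) ⊗ₜ[K] b i)) ?_ j
  apply (homTensorHomEquiv K (V ⊗[K] V) V (V ⊗[K] V) V).injective
  refine TensorProduct.ext_threefold fun x y z ↦ ?_
  have h := LinearMap.congr_fun hassoc.1 ((x ⊗ₜ[K] y) ⊗ₜ[K] z)
  simp [dL_tmul, dR_tmul, hD, TensorProduct.sum_tmul, TensorProduct.tmul_sum] at h ⊢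
  rw [h, Finset.sum_comm]

/-- The coefficients of the second double associativity identity. -/
lemma IsDoubleAssoc.sum_tmul_mul' (hassoc : IsDoubleAssoc D) (ha : LinearIndependent K a)
    (hD : ∀ x y, D (x ⊗ₜ[K] y) = ∑ i, a i x ⊗ₜ[K] b i y) (j : ι) :
    ∑ i, a i ⊗ₜ[K] (b j * b i) = ∑ i, (a i * b j) ⊗ₜ[K] b i := by
  apply (homTensorHomEquiv K V V V V).injective
  refine sum_tmul_left_injective ha
    (x := fun j ↦ homTensorHomEquiv K V V V V (∑ i, a i ⊗ₜ[K] (b j * b i)))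
    (y := fun j ↦ homTensorHomEquiv K V V V V (∑ i, (a i * b j) ⊗ₜ[K] b i)) ?_ j
  apply (homTensorHomEquiv K V (V ⊗[K] V) V (V ⊗[K] V)).injective
  ext x y z
  have h := congrArg (TensorProduct.assoc K V V V)
    (LinearMap.congr_fun hassoc.2 ((x ⊗ₜ[K] y) ⊗ₜ[K] z))
  simp [dL_tmul, dR_tmul, hD, TensorProduct.sum_tmul, TensorProduct.tmul_sum] at h ⊢
  rw [Finset.sum_comm, h]

end DoubleBracket

/-- A tensor whose legs span the same unital algebra and which intertwines left and right
multiplications is symmetric. -/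
lemma sum_tmul_comm_of_casimir {K A ι : Type*} [Field K] [Ring A] [Algebra K A] [Fintype ι]
    {a b : ι → A} (ha : LinearIndependent K a) (hb : LinearIndependent K b)
    (hspan : Submodule.span K (Set.range a) = Submodule.span K (Set.range b))
    (hone : 1 ∈ Submodule.span K (Set.range a))
    (h₁ : ∀ j, ∑ i, a i ⊗ₜ[K] (b i * a j) = ∑ i, (a j * a i) ⊗ₜ[K] b i)
    (h₂ : ∀ j, ∑ i, a i ⊗ₜ[K] (b j * b i) = ∑ i, (a i * b j) ⊗ₜ[K] b i) :
    ∑ i, b i ⊗ₜ[K] a i = ∑ i, a i ⊗ₜ[K] b i := by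
  classical
  obtain ⟨c, hc⟩ := (Submodule.mem_span_range_iff_exists_fun K).mp hone
  obtain ⟨φ, hφ⟩ := hb.exists_linearForm c
  have hleft (j) : ∑ i, φ (b i * a j) • a i = a j := by
    have h := congrArg (contractTensorRight φ) (h₁ j)
    simp only [map_sum, contractTensorRight_tmul, hφ] at h
    rw [h]
    simp_rw [← mul_smul_comm, ← Finset.mul_sum, hc, mul_one]
  have hright (j) : ∑ i, φ (b j * b i) • a i = b j := by
    have h := congrArg (contractTensorRight φ) (h₂ j)
    simp only [map_sum, contractTensorRight_tmul, hφ] at h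
    rw [h]
    simp_rw [← smul_mul_assoc, ← Finset.sum_mul, hc, one_mul]
  have hdual (i j) : φ (b i * a j) = if i = j then 1 else 0 := by
    have h : ∑ i, φ (b i * a j) • a i = ∑ i, (if i = j then (1 : K) else 0) • a i := by
      rw [hleft]; simp
    exact congrFun (ha.fintypeLinearCombination_injective h) i
  have hright' (x) (hx : x ∈ Submodule.span K (Set.range b)) :
      ∑ i, φ (x * b i) • a i = x := by
    induction hx using Submodule.span_induction with
    | mem x h => obtain ⟨j, rfl⟩ := h; exact hright j
    | zero => simp
    | add x y _ _ hx hy => simp only [add_mul, map_add, add_smul, Finset.sum_add_distrib, hx, hy]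
    | smul c x _ hx => simp only [smul_mul_assoc, map_smul, smul_assoc, ← Finset.smul_sum, hx]
  have ha_mem (j) : a j ∈ Submodule.span K (Set.range b) :=
    hspan ▸ Submodule.subset_span ⟨j, rfl⟩
  have hdual' (i j) : φ (a j * b i) = if i = j then 1 else 0 := by
    have h : ∑ i, φ (a j * b i) • a i = ∑ i, (if i = j then (1 : K) else 0) • a i := by
      rw [hright' _ (ha_mem j)]; simp
    exact congrFun (ha.fintypeLinearCombination_injective h) i
  have hcomm (x) (hx : x ∈ Submodule.span K (Set.range b)) (j) : φ (x * a j) = φ (a j * x) := by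
    induction hx using Submodule.span_induction with
    | mem x h => obtain ⟨i, rfl⟩ := h; rw [hdual, hdual']
    | zero => simp
    | add x y _ _ hx hy => simp only [add_mul, mul_add, map_add, hx, hy]
    | smul c x _ hx => simp only [smul_mul_assoc, mul_smul_comm, map_smul, hx]
  have hexpand (x) (hx : x ∈ Submodule.span K (Set.range b)) :
      x = ∑ j, φ (x * a j) • b j := by
    induction hx using Submodule.span_induction with
    | mem x h => obtain ⟨i, rfl⟩ := h; simp [hdual]
    | zero => simp
    | add x y _ _ hx hy =>
      simp only [add_mul, map_add, add_smul, Finset.sum_add_distrib, ← hx, ← hy]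
    | smul c x _ hx => simp only [smul_mul_assoc, map_smul, smul_assoc, ← Finset.smul_sum, ← hx]
  calc ∑ i, b i ⊗ₜ[K] a i
      = ∑ i, b i ⊗ₜ[K] ∑ j, φ (a i * a j) • b j :=
        Finset.sum_congr rfl fun i _ ↦ by rw [← hexpand _ (ha_mem i)]
    _ = ∑ i, ∑ j, φ (a i * a j) • (b i ⊗ₜ[K] b j) := by
        simp only [TensorProduct.tmul_sum, TensorProduct.tmul_smul]
    _ = ∑ j, ∑ i, φ (a i * a j) • (b i ⊗ₜ[K] b j) := Finset.sum_comm
    _ = ∑ j, (∑ i, φ (a j * a i) • b i) ⊗ₜ[K] b j := by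
        simp only [TensorProduct.sum_tmul, TensorProduct.smul_tmul', hcomm _ (ha_mem _)]
    _ = ∑ j, a j ⊗ₜ[K] b j :=
        Finset.sum_congr rfl fun j _ ↦ by rw [← hexpand _ (ha_mem j)]

/-- Theorem 3: every simple finite-dimensional associative double algebra is commutative. -/
theorem stmt16 {K V : Type*} [Field K] [AddCommGroup V] [Module K V]
    [FiniteDimensional K V]
    (D : V ⊗[K] V →ₗ[K] V ⊗[K] V)
    (hassoc : IsDoubleAssoc D) (hsimple : IsSimpleDouble D) :
    flipT K V ∘ₗ D ∘ₗ flipT K V = D := by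
  obtain ⟨k, a, b, ha, hb, hr⟩ :=
    exists_sum_tmul_linearIndependent ((homTensorHomEquiv K V V V V).symm D)
  rw [LinearEquiv.symm_apply_eq] at hr
  have hD (x y) : D (x ⊗ₜ[K] y) = ∑ i, a i x ⊗ₜ[K] b i y := by
    rw [hr]; simp
  have h₁ := hassoc.sum_tmul_mul hb hD
  have h₂ := hassoc.sum_tmul_mul' ha hD
  obtain ⟨L, hL⟩ : ∃ L, L = Submodule.span K (Set.range a) := ⟨_, rfl⟩
  obtain ⟨M, hM⟩ : ∃ M, M = Submodule.span K (Set.range b) := ⟨_, rfl⟩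
  have hLL : L * L ≤ L := by
    rw [hL, Submodule.span_mul_span, Submodule.span_le]
    rintro _ ⟨_, ⟨j, rfl⟩, _, ⟨i, rfl⟩, rfl⟩
    exact mem_span_of_sum_tmul_eq hb (h₁ j).symm i
  have hML : M * L ≤ M := by
    rw [hL, hM, Submodule.span_mul_span, Submodule.span_le]
    rintro _ ⟨_, ⟨i, rfl⟩, _, ⟨j, rfl⟩, rfl⟩
    exact mem_span_of_sum_tmul_eq' ha (h₁ j) i
  have hMM : M * M ≤ M := by
    rw [hM, Submodule.span_mul_span, Submodule.span_le]
    rintro _ ⟨_, ⟨j, rfl⟩, _, ⟨i, rfl⟩, rfl⟩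
    exact mem_span_of_sum_tmul_eq' ha (h₂ j) i
  have hLM : L * M ≤ L := by
    rw [hL, hM, Submodule.span_mul_span, Submodule.span_le]
    rintro _ ⟨_, ⟨i, rfl⟩, _, ⟨j, rfl⟩, rfl⟩
    exact mem_span_of_sum_tmul_eq hb (h₂ j).symm i
  have haL (i) : a i ∈ L := hL ▸ Submodule.subset_span ⟨i, rfl⟩
  have hbM (i) : b i ∈ M := hM ▸ Submodule.subset_span ⟨i, rfl⟩
  have hirr (I : Submodule K V) (hI : ∀ x ∈ L ⊔ M, ∀ v ∈ I, x v ∈ I) : I = ⊥ ∨ I = ⊤ :=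
    hsimple.2 I (isDoubleIdeal_of_invariant_s16 hD (fun i ↦ hI _ (Submodule.mem_sup_left (haL i)))
      (fun i ↦ hI _ (Submodule.mem_sup_right (hbM i))))
  have hone_L : 1 ∈ L := one_mem_of_irreducible_s16 L M hLL hML hMM hLM
    (hsimple.eq_zero_of_left hD hL hM hLM hLL)
    (fun I hI ↦ hsimple.eq_top_of_left hD fun i ↦ hI _ (haL i)) hirr
  have hone_M : 1 ∈ M := one_mem_of_irreducible_s16 M L hMM hLM hLL hML
    (hsimple.eq_zero_of_right hD hL hM hML hMM)
    (fun I hI ↦ hsimple.eq_top_of_right hD fun i ↦ hI _ (hbM i)) (by rwa [sup_comm])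
  have heq : L = M := le_antisymm
    (fun x hx ↦ by simpa using hML (Submodule.mul_mem_mul hone_M hx))
    (fun x hx ↦ by simpa using hLM (Submodule.mul_mem_mul hone_L hx))
  have hsymm := sum_tmul_comm_of_casimir ha hb (hL ▸ hM ▸ heq) (hL ▸ hone_L) h₁ h₂
  ext x y
  have h := LinearMap.congr_fun (congrArg (homTensorHomEquiv K V V V V) hsymm) (x ⊗ₜ[K] y)
  simpa [hD] using h
end

section
/- Let K be a field, V and U K-vector spaces, D_V a double bracket on V satisfying the double Lie identities, and D_U a double bracket on U satisfying the double associativity identities together with the double commutativity τ_U∘D_U∘τ_U = D_U. Then the induced double bracket D on W = V ⊗[K] U, defined by D = P ∘ (D_V ⊗ D_U) ∘ P⁻¹ where P : (V⊗V)⊗(U⊗U) → (V⊗U)⊗(V⊗U) is the canonical middle-swap isomorphism, satisfies the double Lie identities. -/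
open TensorProduct

/-- The induced double bracket on `V ⊗ U` built from double brackets on `V` and `U` via
the canonical middle-swap isomorphism `(V⊗V)⊗(U⊗U) ≃ (V⊗U)⊗(V⊗U)`. -/
noncomputable def inducedBracket {K V U : Type*} [Field K]
    [AddCommGroup V] [Module K V] [AddCommGroup U] [Module K U]
    (DV : V ⊗[K] V →ₗ[K] V ⊗[K] V) (DU : U ⊗[K] U →ₗ[K] U ⊗[K] U) :
    (V ⊗[K] U) ⊗[K] (V ⊗[K] U) →ₗ[K] (V ⊗[K] U) ⊗[K] (V ⊗[K] U) :=
  (TensorProduct.tensorTensorTensorComm K V V U U).toLinearMap ∘ₗ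
    TensorProduct.map DV DU ∘ₗ
      (TensorProduct.tensorTensorTensorComm K V V U U).symm.toLinearMap

section DoubleBracketLemmas

variable {K : Type*} [Field K] {X V U : Type*} [AddCommGroup X] [Module K X]
  [AddCommGroup V] [Module K V] [AddCommGroup U] [Module K U]

theorem t12_comp_t12 : t12 K X ∘ₗ t12 K X = LinearMap.id := by
  ext a b c
  simp [t12, flipT]

theorem t23_comp_t23 : t23 K X ∘ₗ t23 K X = LinearMap.id := by
  ext a b c
  simp [t23, flipT]

/-- `id ⊗ D` is the conjugate of `D ⊗ id` by the cyclic permutation. -/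
theorem dR_eq_conj (D : X ⊗[K] X →ₗ[K] X ⊗[K] X) :
    dR D = t12 K X ∘ₗ t23 K X ∘ₗ dL D ∘ₗ t23 K X ∘ₗ t12 K X := by
  ext a b c
  simp only [dR, dL, t12, t23, flipT, TensorProduct.AlgebraTensorModule.curry_apply,
    LinearMap.restrictScalars_self, TensorProduct.curry_apply, LinearMap.coe_comp,
    Function.comp_apply, LinearEquiv.coe_coe, TensorProduct.assoc_tmul, TensorProduct.map_tmul,
    LinearMap.id_coe, id_eq, TensorProduct.comm_tmul, TensorProduct.assoc_symm_tmul]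
  generalize D (b ⊗ₜ[K] c) = x
  induction x using TensorProduct.induction_on with
  | zero => simp
  | tmul x y => simp
  | add x y hx hy => simp only [tmul_add, add_tmul, map_add, hx, hy]

theorem t12_dL_t12 {D : X ⊗[K] X →ₗ[K] X ⊗[K] X} (h : flipT K X ∘ₗ D ∘ₗ flipT K X = D) :
    t12 K X ∘ₗ dL D ∘ₗ t12 K X = dL D := by
  simp only [t12, dL, ← TensorProduct.map_comp, h, LinearMap.id_comp]

theorem t23_dR_t23 {D : X ⊗[K] X →ₗ[K] X ⊗[K] X} (h : flipT K X ∘ₗ D ∘ₗ flipT K X = D) :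
    t23 K X ∘ₗ dR D ∘ₗ t23 K X = dR D := by
  conv_rhs => rw [← h]
  ext a b c
  simp [t23, dR]

/-- For involutions `s`, `t` generating the permutations of three slots, if `L`, `R` stand for
a symmetric operator on the slots `12`, `23`, then `L R = (t L t) L` implies
`R (s R s) = L R`. -/
theorem mul_conj_eq_of_involutive {M : Type*} [Monoid M] {s t L R : M}
    (hs : s * s = 1) (ht : t * t = 1) (hL : s * (L * s) = L) (hR : t * (R * t) = R)
    (hRL : R = s * (t * (L * (t * s)))) (hLR : L * R = t * (L * (t * L))) :
    R * (s * (R * s)) = L * R := by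
  have hs' (x : M) : s * (s * x) = x := by rw [← mul_assoc, hs, one_mul]
  have h : s * (R * s) = t * (L * t) := by
    rw [hRL]
    simp only [mul_assoc, hs', hs, mul_one]
  have hsL : s * L = L * s := by
    conv_rhs => rw [← hL]
    simp only [mul_assoc, hs, mul_one]
  have htR : R * t = t * R := by
    conv_lhs => rw [← hR]
    simp only [mul_assoc, ht, mul_one]
  calc R * (s * (R * s)) = R * t * (L * t) := by rw [h, mul_assoc]
    _ = t * R * (s * (L * s) * t) := by rw [htR, hL]
    _ = t * (s * (s * (R * s) * (L * (s * t)))) := by simp only [mul_assoc, hs']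
    _ = t * (s * (L * R * (s * t))) := by rw [h, hLR]; simp only [mul_assoc]
    _ = t * (s * L * (R * (s * t))) := by simp only [mul_assoc]
    _ = t * (L * (s * (R * s) * t)) := by rw [hsL]; simp only [mul_assoc]
    _ = L * R := by rw [h, hLR]; simp only [mul_assoc, ht, mul_one]

/-- In a commutative associative double algebra, `D₂₃ D₁₃ = D₁₂ D₂₃`. -/
theorem IsDoubleAssoc.dR_t12_dR_t12 {D : X ⊗[K] X →ₗ[K] X ⊗[K] X} (hD : IsDoubleAssoc D)
    (h : flipT K X ∘ₗ D ∘ₗ flipT K X = D) :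
    dR D ∘ₗ t12 K X ∘ₗ dR D ∘ₗ t12 K X = dL D ∘ₗ dR D :=
  mul_conj_eq_of_involutive (M := Module.End K ((X ⊗[K] X) ⊗[K] X)) t12_comp_t12
    t23_comp_t23 (t12_dL_t12 h) (t23_dR_t23 h) (dR_eq_conj D) hD.1

/-- The canonical isomorphism `V^⊗3 ⊗ U^⊗3 ≃ (V ⊗ U)^⊗3`. -/
noncomputable def tripleTensorComm (K V U : Type*) [Field K]
    [AddCommGroup V] [Module K V] [AddCommGroup U] [Module K U] :
    ((V ⊗[K] V) ⊗[K] V) ⊗[K] ((U ⊗[K] U) ⊗[K] U) ≃ₗ[K]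
      ((V ⊗[K] U) ⊗[K] (V ⊗[K] U)) ⊗[K] (V ⊗[K] U) :=
  TensorProduct.tensorTensorTensorComm K (V ⊗[K] V) V (U ⊗[K] U) U ≪≫ₗ
    TensorProduct.congr (TensorProduct.tensorTensorTensorComm K V V U U) (LinearEquiv.refl K _)

theorem t12_tripleTensorComm (x : (V ⊗[K] V) ⊗[K] V) (y : (U ⊗[K] U) ⊗[K] U) :
    t12 K (V ⊗[K] U) (tripleTensorComm K V U (x ⊗ₜ y)) =
      tripleTensorComm K V U (t12 K V x ⊗ₜ t12 K U y) := by
  suffices t12 K (V ⊗[K] U) ∘ₗ (tripleTensorComm K V U).toLinearMap =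
      (tripleTensorComm K V U).toLinearMap ∘ₗ TensorProduct.map (t12 K V) (t12 K U) from
    LinearMap.congr_fun this (x ⊗ₜ y)
  ext a b c d e f
  simp [t12, flipT, tripleTensorComm]

theorem t23_tripleTensorComm (x : (V ⊗[K] V) ⊗[K] V) (y : (U ⊗[K] U) ⊗[K] U) :
    t23 K (V ⊗[K] U) (tripleTensorComm K V U (x ⊗ₜ y)) =
      tripleTensorComm K V U (t23 K V x ⊗ₜ t23 K U y) := by
  suffices t23 K (V ⊗[K] U) ∘ₗ (tripleTensorComm K V U).toLinearMap =
      (tripleTensorComm K V U).toLinearMap ∘ₗ TensorProduct.map (t23 K V) (t23 K U) from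
    LinearMap.congr_fun this (x ⊗ₜ y)
  ext a b c d e f
  simp [t23, flipT, tripleTensorComm]

theorem dL_tripleTensorComm (DV : V ⊗[K] V →ₗ[K] V ⊗[K] V) (DU : U ⊗[K] U →ₗ[K] U ⊗[K] U)
    (x : (V ⊗[K] V) ⊗[K] V) (y : (U ⊗[K] U) ⊗[K] U) :
    dL (inducedBracket DV DU) (tripleTensorComm K V U (x ⊗ₜ y)) =
      tripleTensorComm K V U (dL DV x ⊗ₜ dL DU y) := by
  suffices dL (inducedBracket DV DU) ∘ₗ (tripleTensorComm K V U).toLinearMap =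
      (tripleTensorComm K V U).toLinearMap ∘ₗ TensorProduct.map (dL DV) (dL DU) from
    LinearMap.congr_fun this (x ⊗ₜ y)
  ext a b c d e f
  simp [dL, inducedBracket, tripleTensorComm]

theorem dR_tripleTensorComm (DV : V ⊗[K] V →ₗ[K] V ⊗[K] V) (DU : U ⊗[K] U →ₗ[K] U ⊗[K] U)
    (x : (V ⊗[K] V) ⊗[K] V) (y : (U ⊗[K] U) ⊗[K] U) :
    dR (inducedBracket DV DU) (tripleTensorComm K V U (x ⊗ₜ y)) =
      tripleTensorComm K V U (dR DV x ⊗ₜ dR DU y) := by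
  simp only [dR_eq_conj, LinearMap.comp_apply, t12_tripleTensorComm, t23_tripleTensorComm,
    dL_tripleTensorComm]

theorem flipT_tensorTensorTensorComm (x : V ⊗[K] V) (y : U ⊗[K] U) :
    flipT K (V ⊗[K] U) (TensorProduct.tensorTensorTensorComm K V V U U (x ⊗ₜ y)) =
      TensorProduct.tensorTensorTensorComm K V V U U (flipT K V x ⊗ₜ flipT K U y) := by
  suffices flipT K (V ⊗[K] U) ∘ₗ
      (TensorProduct.tensorTensorTensorComm K V V U U).toLinearMap =
      (TensorProduct.tensorTensorTensorComm K V V U U).toLinearMap ∘ₗ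
        TensorProduct.map (flipT K V) (flipT K U) from
    LinearMap.congr_fun this (x ⊗ₜ y)
  ext a b c d
  simp [flipT]

theorem inducedBracket_tensorTensorTensorComm (DV : V ⊗[K] V →ₗ[K] V ⊗[K] V)
    (DU : U ⊗[K] U →ₗ[K] U ⊗[K] U) (x : V ⊗[K] V) (y : U ⊗[K] U) :
    inducedBracket DV DU (TensorProduct.tensorTensorTensorComm K V V U U (x ⊗ₜ y)) =
      TensorProduct.tensorTensorTensorComm K V V U U (DV x ⊗ₜ DU y) := by
  simp only [inducedBracket, LinearMap.comp_apply, LinearEquiv.coe_coe,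
    LinearEquiv.symm_apply_apply, TensorProduct.map_tmul]

end DoubleBracketLemmas

/-- If `V` is a Lie double algebra and `U` is a commutative (associative) double algebra,
then `V ⊗ U` with the induced double bracket is a Lie double algebra. -/
theorem stmt18 {K V U : Type*} [Field K]
    [AddCommGroup V] [Module K V] [AddCommGroup U] [Module K U]
    (DV : V ⊗[K] V →ₗ[K] V ⊗[K] V) (DU : U ⊗[K] U →ₗ[K] U ⊗[K] U)
    (hV : IsDoubleLie DV)
    (hU : IsDoubleAssoc DU) (hUc : flipT K U ∘ₗ DU ∘ₗ flipT K U = DU) :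
    IsDoubleLie (inducedBracket DV DU) := by
  constructor
  · rw [← LinearMap.cancel_right (TensorProduct.tensorTensorTensorComm K V V U U).surjective]
    refine TensorProduct.ext' fun x y => ?_
    have h1 := LinearMap.congr_fun hV.1 x
    have h2 := LinearMap.congr_fun hUc y
    simp only [LinearMap.comp_apply, LinearMap.neg_apply] at h1 h2
    simp only [LinearMap.comp_apply, LinearMap.neg_apply, LinearEquiv.coe_coe,
      flipT_tensorTensorTensorComm, inducedBracket_tensorTensorTensorComm, h1, h2, neg_tmul,
      map_neg]
  · rw [← LinearMap.cancel_right (tripleTensorComm K V U).surjective]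
    refine TensorProduct.ext' fun x y => ?_
    have h1 := LinearMap.congr_fun hV.2 x
    have h2 := LinearMap.congr_fun (hU.dR_t12_dR_t12 hUc) y
    have h3 := LinearMap.congr_fun hU.1 y
    simp only [LinearMap.comp_apply, LinearMap.sub_apply] at h1 h2 h3
    set D := inducedBracket DV DU with hD
    set w := tripleTensorComm K V U (x ⊗ₜ y) with hw
    change dL D (dR D w) - dR D (t12 K _ (dR D (t12 K _ w))) = t23 K _ (dL D (t23 K _ (dL D w)))
    simp only [hD, hw, t12_tripleTensorComm, t23_tripleTensorComm, dL_tripleTensorComm,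
      dR_tripleTensorComm]
    rw [h2, ← h3, ← h1, sub_tmul, map_sub]
end
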